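/- The loss functional E : L²(ρ) → ℝ is Fréchet differentiable at every φ ∈ L²(ρ), and its Fréchet derivative at φ is the bounded linear functional ψ ↦ 2⟨L_Ḡ φ − φ^f, ψ⟩_{L²(ρ)}; i.e., the gradient of E at φ in L²(ρ) is 2(L_Ḡ φ − φ^f). -/

import Mathlib

open MeasureTheory Set
open scoped BigOperators RealInnerProductSpace ENNReal

noncomputable section

/-- The 1D data-based integral kernel `G`. -/
def Gker (N : ℕ) (u : Fin N → ℝ → ℝ) (r s : ℝ) : ℝ :=
  (N : ℝ)⁻¹ * ∑ i, ∫ x, (u i (x + r) + u i (x - r) - 2 * u i x) *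
    (u i (x + s) + u i (x - s) - 2 * u i x)

/-- The reweighted kernel `Ḡ(r,s) = G(r,s) / (p(r) p(s))`. -/
def Gbar (N : ℕ) (u : Fin N → ℝ → ℝ) (p : ℝ → ℝ) (r s : ℝ) : ℝ :=
  Gker N u r s / (p r * p s)

/-- The nonlocal operator `L_φ[u]` for `φ ∈ L²(ρ)`, using the canonical representative of `φ`
extended by zero outside `[0,R₀]`. -/
def LopLp (R₀ : ℝ) {ρ : Measure ℝ} (φ : Lp ℝ 2 ρ) (u : ℝ → ℝ) (x : ℝ) : ℝ :=
  ∫ y, (Set.Icc 0 R₀).indicator (φ : ℝ → ℝ) |y - x| * (u y - u x)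

/-- The loss functional `E(φ) = (1/N) Σ_i ‖L_φ[u_i] - f_i‖²_{L²(ℝ)}`. -/
def lossE (R₀ : ℝ) {ρ : Measure ℝ} (N : ℕ) (u : Fin N → ℝ → ℝ) (f : Fin N → ℝ → ℝ)
    (φ : Lp ℝ 2 ρ) : ℝ :=
  (N : ℝ)⁻¹ * ∑ i, ∫ x, (LopLp R₀ φ (u i) x - f i x) ^ 2

def vk (u : ℝ → ℝ) (x r : ℝ) : ℝ := u (x + r) + u (x - r) - 2 * u x

theorem vk_cont {u : ℝ → ℝ} (hu : Continuous u) : Continuous (fun z : ℝ × ℝ => vk u z.1 z.2) := by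
  unfold vk; fun_prop

theorem u_bdd {u : ℝ → ℝ} (hu : Continuous u) (hc : HasCompactSupport u) :
    ∃ C, ∀ x, |u x| ≤ C := by
  obtain ⟨C, hC⟩ := hc.exists_bound_of_continuous hu
  exact ⟨C, hC⟩

theorem vk_bound (R₀ : ℝ) {u : ℝ → ℝ} (hu : Continuous u) (hc : HasCompactSupport u) :
    ∃ (C : ℝ) (B : ℝ → ℝ), 0 ≤ C ∧ Integrable B ∧ (∀ x, 0 ≤ B x) ∧ (∀ x, B x ≤ C) ∧
      ∀ r ∈ Icc 0 R₀, ∀ x, |vk u x r| ≤ B x := by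
  obtain ⟨M, hM⟩ := u_bdd hu hc
  obtain ⟨K, hK⟩ := hc.isCompact.isBounded.subset_closedBall 0
  have hM0 : 0 ≤ M := (abs_nonneg _).trans (hM 0)
  have hz : ∀ y, K < |y| → u y = 0 := by
    intro y hy
    by_contra h
    have := hK (subset_tsupport u h)
    simp at this
    linarith
  refine ⟨4 * M, (Icc (-(K + R₀)) (K + R₀)).indicator (fun _ => 4 * M), by positivity, ?_, ?_, ?_, ?_⟩
  · rw [integrable_indicator_iff measurableSet_Icc]
    exact integrableOn_const (by simp)
  · intro x; exact indicator_nonneg (fun _ _ => by positivity) _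
  · intro x; exact indicator_le_self' (fun _ _ => by positivity) _
  · intro r hr x
    by_cases hx : x ∈ Icc (-(K + R₀)) (K + R₀)
    · rw [indicator_of_mem hx]
      unfold vk
      have h1 := abs_le.1 (hM (x + r))
      have h2 := abs_le.1 (hM (x - r))
      have h3 := abs_le.1 (hM x)
      rw [abs_le]; constructor <;> linarith
    · rw [indicator_of_notMem hx]
      have hx' : K + R₀ < |x| := by
        by_contra h
        exact hx (abs_le.1 (not_lt.1 h))
      have h0 := hr.1
      have h1 := hr.2
      unfold vk
      rw [hz (x + r), hz (x - r), hz x]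
      · simp
      · linarith
      · rcases lt_abs.1 hx' with h | h
        · exact lt_abs.2 (Or.inl (by linarith))
        · exact lt_abs.2 (Or.inr (by linarith))
      · rcases lt_abs.1 hx' with h | h
        · exact lt_abs.2 (Or.inl (by linarith))
        · exact lt_abs.2 (Or.inr (by linarith))

/-- folding the integral over the line -/
theorem fold (R₀ : ℝ) (g : ℝ → ℝ) (hgm : StronglyMeasurable g)
    (hg : IntegrableOn g (Icc 0 R₀)) {u : ℝ → ℝ} (hu : Continuous u) (hc : HasCompactSupport u)
    (x : ℝ) :
    ∫ y, (Set.Icc 0 R₀).indicator g |y - x| * (u y - u x) = ∫ r in Icc 0 R₀, g r * vk u x r := by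
  obtain ⟨M, hM⟩ := u_bdd hu hc
  set G := (Set.Icc 0 R₀).indicator g with hG
  have hGm : StronglyMeasurable G := hgm.indicator measurableSet_Icc
  have hGi : Integrable G := (integrable_indicator_iff measurableSet_Icc).2 hg
  have hGa : Integrable (fun z => G |z|) := by
    refine Integrable.mono' (hGi.norm.add hGi.comp_neg.norm)
      (hGm.comp_measurable measurable_norm).aestronglyMeasurable (ae_of_all _ fun z => ?_)
    rcases abs_choice z with h | h <;> simp only [h, Pi.add_apply]
    · linarith [norm_nonneg (G (-z))]
    · linarith [norm_nonneg (G z)]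
  have hFi : Integrable (fun z => G |z| * (u (x + z) - u x)) := by
    refine hGa.mul_bdd (c := 2 * M) (by fun_prop) (ae_of_all _ fun z => ?_)
    have h1 := abs_le.1 (hM (x + z))
    have h3 := abs_le.1 (hM x)
    rw [Real.norm_eq_abs, abs_le]; constructor <;> linarith
  have e1 : ∫ y, G |y - x| * (u y - u x) = ∫ z, G |z| * (u (x + z) - u x) := by
    rw [← integral_add_right_eq_self _ x]
    congr 1; ext z; rw [add_sub_cancel_right, add_comm z x]
  have e2 : ∫ z in Iic (0:ℝ), G |z| * (u (x + z) - u x) =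
      ∫ z in Ioi (0:ℝ), G |-z| * (u (x + -z) - u x) := by
    rw [integral_comp_neg_Ioi (0:ℝ) (fun z => G |z| * (u (x + z) - u x)), neg_zero]
  rw [e1, ← intervalIntegral.integral_Iic_add_Ioi hFi.integrableOn hFi.integrableOn (b := 0), e2,
    ← integral_add hFi.comp_neg.integrableOn hFi.integrableOn]
  have e3 : ∀ z ∈ Ioi (0:ℝ), G |-z| * (u (x + -z) - u x) + G |z| * (u (x + z) - u x) =
      (Icc 0 R₀).indicator (fun r => g r * vk u x r) z := by
    intro z hz
    rw [abs_neg, abs_of_pos hz, indicator_mul_left]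
    simp only [← hG, vk, sub_eq_add_neg]
    ring
  rw [setIntegral_congr_fun measurableSet_Ioi e3, setIntegral_indicator measurableSet_Icc,
    integral_Icc_eq_integral_Ioc]
  congr 2
  ext z; simp only [mem_inter_iff, mem_Ioi, mem_Icc, mem_Ioc]
  constructor
  · rintro ⟨a, b, c⟩; exact ⟨a, c⟩
  · rintro ⟨a, c⟩; exact ⟨a, a.le, c⟩

section
variable {R₀ : ℝ} {v : ℝ → ℝ → ℝ} {B : ℝ → ℝ} {C : ℝ}

theorem fubI (hv : Continuous (fun z : ℝ × ℝ => v z.1 z.2)) (hBi : Integrable B)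
    (hB : ∀ r ∈ Icc 0 R₀, ∀ x, |v x r| ≤ B x)
    (g : ℝ → ℝ) (hgm : StronglyMeasurable g) (hg : IntegrableOn g (Icc 0 R₀))
    (F : ℝ → ℝ) (hFm : StronglyMeasurable F) (D : ℝ) (hF : ∀ x, |F x| ≤ D) :
    Integrable (Function.uncurry fun r x => g r * (F x * v x r))
      ((volume.restrict (Icc 0 R₀)).prod (volume : Measure ℝ)) := by
  have hm : StronglyMeasurable (Function.uncurry fun r x => g r * (F x * v x r)) := by
    refine (hgm.comp_measurable measurable_fst).mul
      ((hFm.comp_measurable measurable_snd).mul ?_)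
    exact (hv.comp continuous_swap).stronglyMeasurable
  refine Integrable.mono' (hg.norm.mul_prod (hBi.const_mul D)) hm.aestronglyMeasurable ?_
  have : ∀ᵐ z ∂((volume.restrict (Icc 0 R₀)).prod (volume : Measure ℝ)), z.1 ∈ Icc 0 R₀ := by
    have := (Measure.quasiMeasurePreserving_fst (μ := volume.restrict (Icc 0 R₀))
      (ν := (volume : Measure ℝ))).ae
      (ae_restrict_mem (μ := volume) (s := Icc (0:ℝ) R₀) measurableSet_Icc)
    exact this
  filter_upwards [this] with z hz
  simp only [Function.uncurry, norm_mul, Real.norm_eq_abs]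
  have hD : 0 ≤ D := (abs_nonneg _).trans (hF 0)
  have := hB _ hz z.2
  have := hF z.2
  gcongr

theorem fub (hv : Continuous (fun z : ℝ × ℝ => v z.1 z.2)) (hBi : Integrable B)
    (hB : ∀ r ∈ Icc 0 R₀, ∀ x, |v x r| ≤ B x)
    (g : ℝ → ℝ) (hgm : StronglyMeasurable g) (hg : IntegrableOn g (Icc 0 R₀))
    (F : ℝ → ℝ) (hFm : StronglyMeasurable F) (D : ℝ) (hF : ∀ x, |F x| ≤ D) :
    IntegrableOn (fun r => g r * ∫ x, F x * v x r) (Icc 0 R₀) ∧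
    ∫ r in Icc 0 R₀, g r * ∫ x, F x * v x r = ∫ x, F x * ∫ r in Icc 0 R₀, g r * v x r := by
  have hI := fubI hv hBi hB g hgm hg F hFm D hF
  simp_rw [← integral_const_mul]
  refine ⟨hI.integral_prod_left, ?_⟩
  rw [integral_integral_swap hI]
  congr 1; ext x; congr 1; ext r; ring

end

section
variable {R₀ : ℝ} {p : ℝ → ℝ} {ρ : Measure ℝ}

theorem p_aem (hpc : ContinuousOn p (Set.Icc 0 R₀)) :
    AEMeasurable (fun r => ENNReal.ofReal (p r)) (volume.restrict (Set.Icc 0 R₀)) :=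
  (hpc.aemeasurable measurableSet_Icc).ennreal_ofReal

theorem rho_int (hpc : ContinuousOn p (Set.Icc 0 R₀)) (hpp : ∀ r ∈ Set.Icc 0 R₀, 0 < p r)
    (hρ : ρ = (volume.restrict (Set.Icc 0 R₀)).withDensity fun r => ENNReal.ofReal (p r))
    (g : ℝ → ℝ) : ∫ r, g r ∂ρ = ∫ r in Icc 0 R₀, p r * g r := by
  rw [hρ, integral_withDensity_eq_integral_toReal_smul₀ (p_aem hpc) (by simp)]
  refine setIntegral_congr_fun measurableSet_Icc fun r hr => ?_
  simp [ENNReal.toReal_ofReal (hpp r hr).le]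

theorem rho_integrable (hpc : ContinuousOn p (Set.Icc 0 R₀)) (hpp : ∀ r ∈ Set.Icc 0 R₀, 0 < p r)
    (hρ : ρ = (volume.restrict (Set.Icc 0 R₀)).withDensity fun r => ENNReal.ofReal (p r))
    (g : ℝ → ℝ) (hg : Integrable g ρ) : IntegrableOn (fun r => p r * g r) (Icc 0 R₀) := by
  rw [hρ, integrable_withDensity_iff_integrable_smul₀' (p_aem hpc) (by simp)] at hg
  refine hg.congr ?_
  filter_upwards [ae_restrict_mem measurableSet_Icc] with r hr
  simp [ENNReal.toReal_ofReal (hpp r hr).le]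

theorem rho_ac (hpc : ContinuousOn p (Set.Icc 0 R₀)) (hpp : ∀ r ∈ Set.Icc 0 R₀, 0 < p r)
    (hρ : ρ = (volume.restrict (Set.Icc 0 R₀)).withDensity fun r => ENNReal.ofReal (p r)) :
    volume.restrict (Set.Icc 0 R₀) ≪ ρ := by
  rw [hρ]
  refine withDensity_absolutelyContinuous' (p_aem hpc) ?_
  filter_upwards [ae_restrict_mem measurableSet_Icc] with r hr
  simpa using hpp r hr

theorem rho_lp [IsProbabilityMeasure ρ] (hR₀ : 0 < R₀)
    (hpc : ContinuousOn p (Set.Icc 0 R₀)) (hpp : ∀ r ∈ Set.Icc 0 R₀, 0 < p r)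
    (hρ : ρ = (volume.restrict (Set.Icc 0 R₀)).withDensity fun r => ENNReal.ofReal (p r)) :
    ∃ c : ℝ, 0 ≤ c ∧ ∀ φ : Lp ℝ 2 ρ, IntegrableOn (φ : ℝ → ℝ) (Icc 0 R₀) ∧
      ∫ r in Icc 0 R₀, |φ r| ≤ c * ‖φ‖ := by
  obtain ⟨r0, hr0, hmin⟩ := isCompact_Icc.exists_isMinOn (nonempty_Icc.2 hR₀.le) hpc
  have hm := hpp r0 hr0
  refine ⟨(p r0)⁻¹, by positivity, fun φ => ?_⟩
  have hφi : Integrable (φ : ℝ → ℝ) ρ := (Lp.memLp φ).integrable (by norm_num)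
  have h1 : IntegrableOn (fun r => p r * |φ r|) (Icc 0 R₀) := by
    exact rho_integrable hpc hpp hρ _ hφi.abs
  have hb : ∀ r ∈ Icc 0 R₀, |φ r| ≤ (p r0)⁻¹ * (p r * |φ r|) := by
    intro r hr
    have : p r0 ≤ p r := hmin hr
    rw [← mul_assoc]
    refine le_mul_of_one_le_left (abs_nonneg _) ?_
    rw [inv_mul_eq_div, one_le_div hm]; exact this
  have h2 : IntegrableOn (φ : ℝ → ℝ) (Icc 0 R₀) := by
    refine Integrable.mono' (h1.const_mul (p r0)⁻¹)
      (Lp.stronglyMeasurable φ).aestronglyMeasurable ?_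
    filter_upwards [ae_restrict_mem measurableSet_Icc] with r hr
    exact hb r hr
  refine ⟨h2, ?_⟩
  calc ∫ r in Icc 0 R₀, |φ r| ≤ ∫ r in Icc 0 R₀, (p r0)⁻¹ * (p r * |φ r|) :=
        setIntegral_mono_on h2.abs (h1.const_mul (p r0)⁻¹) measurableSet_Icc hb
    _ = (p r0)⁻¹ * ∫ r, |φ r| ∂ρ := by rw [integral_const_mul, rho_int hpc hpp hρ]
    _ ≤ (p r0)⁻¹ * ‖φ‖ := by
        gcongr
        have e : ∫ r, |φ r| ∂ρ = (eLpNorm φ 1 ρ).toReal := by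
          rw [eLpNorm_one_eq_lintegral_enorm]
          exact integral_norm_eq_lintegral_enorm hφi.1
        rw [e, Lp.norm_def]
        exact ENNReal.toReal_mono (Lp.eLpNorm_ne_top φ)
          (eLpNorm_le_eLpNorm_of_exponent_le (by norm_num) hφi.1)

theorem Lop_eq [IsProbabilityMeasure ρ] (hR₀ : 0 < R₀)
    (hpc : ContinuousOn p (Set.Icc 0 R₀)) (hpp : ∀ r ∈ Set.Icc 0 R₀, 0 < p r)
    (hρ : ρ = (volume.restrict (Set.Icc 0 R₀)).withDensity fun r => ENNReal.ofReal (p r))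
    {u : ℝ → ℝ} (hu : Continuous u) (hc : HasCompactSupport u) (φ : Lp ℝ 2 ρ) (x : ℝ) :
    LopLp R₀ φ u x = ∫ r in Icc 0 R₀, φ r * vk u x r := by
  obtain ⟨c, -, h⟩ := rho_lp hR₀ hpc hpp hρ
  exact fold R₀ φ (Lp.stronglyMeasurable φ) (h φ).1 hu hc x

theorem Lop_int [IsProbabilityMeasure ρ] (hR₀ : 0 < R₀)
    (hpc : ContinuousOn p (Set.Icc 0 R₀)) (hpp : ∀ r ∈ Set.Icc 0 R₀, 0 < p r)
    (hρ : ρ = (volume.restrict (Set.Icc 0 R₀)).withDensity fun r => ENNReal.ofReal (p r))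
    {u : ℝ → ℝ} (hu : Continuous u) (hc : HasCompactSupport u) (φ : Lp ℝ 2 ρ) (x : ℝ) :
    IntegrableOn (fun r => φ r * vk u x r) (Icc 0 R₀) := by
  obtain ⟨c, -, h⟩ := rho_lp hR₀ hpc hpp hρ
  obtain ⟨C, B, hC, hBi, hB0, hBC, hB⟩ := vk_bound R₀ hu hc
  refine (h φ).1.mul_bdd (c := B x) ?_ ?_
  · exact ((vk_cont hu).comp (Continuous.prodMk_right x)).aestronglyMeasurable
  · filter_upwards [ae_restrict_mem measurableSet_Icc] with r hr
    exact hB r hr x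

theorem Lop_add [IsProbabilityMeasure ρ] (hR₀ : 0 < R₀)
    (hpc : ContinuousOn p (Set.Icc 0 R₀)) (hpp : ∀ r ∈ Set.Icc 0 R₀, 0 < p r)
    (hρ : ρ = (volume.restrict (Set.Icc 0 R₀)).withDensity fun r => ENNReal.ofReal (p r))
    {u : ℝ → ℝ} (hu : Continuous u) (hc : HasCompactSupport u) (φ h : Lp ℝ 2 ρ) (x : ℝ) :
    LopLp R₀ (φ + h) u x = LopLp R₀ φ u x + LopLp R₀ h u x := by
  simp only [Lop_eq hR₀ hpc hpp hρ hu hc]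
  rw [← integral_add (Lop_int hR₀ hpc hpp hρ hu hc φ x) (Lop_int hR₀ hpc hpp hρ hu hc h x)]
  refine integral_congr_ae ?_
  filter_upwards [(rho_ac hpc hpp hρ).ae_le (Lp.coeFn_add φ h)] with r hr
  rw [hr, Pi.add_apply, add_mul]

theorem Lop_props [IsProbabilityMeasure ρ] (hR₀ : 0 < R₀)
    (hpc : ContinuousOn p (Set.Icc 0 R₀)) (hpp : ∀ r ∈ Set.Icc 0 R₀, 0 < p r)
    (hρ : ρ = (volume.restrict (Set.Icc 0 R₀)).withDensity fun r => ENNReal.ofReal (p r))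
    {u : ℝ → ℝ} (hu : Continuous u) (hc : HasCompactSupport u) :
    ∃ K : ℝ, ∀ φ : Lp ℝ 2 ρ, StronglyMeasurable (LopLp R₀ φ u) ∧
      (∃ D, ∀ x, |LopLp R₀ φ u x| ≤ D) ∧ MemLp (LopLp R₀ φ u) 2 ∧
      ∫ x, (LopLp R₀ φ u x) ^ 2 ≤ K * ‖φ‖ ^ 2 := by
  obtain ⟨c, hc0, h⟩ := rho_lp hR₀ hpc hpp hρ
  obtain ⟨C, B, hC, hBi, hB0, hBC, hB⟩ := vk_bound R₀ hu hc
  have hB2 : Integrable (fun x => B x ^ 2) := by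
    refine Integrable.mono' (hBi.const_mul C) (hBi.1.pow 2) (ae_of_all _ fun x => ?_)
    rw [Real.norm_eq_abs, abs_of_nonneg (by positivity), sq]
    exact mul_le_mul_of_nonneg_right (hBC x) (hB0 x)
  refine ⟨c ^ 2 * ∫ x, B x ^ 2, fun φ => ?_⟩
  have hsm : StronglyMeasurable (LopLp R₀ φ u) := by
    have : LopLp R₀ φ u = fun x => ∫ r in Icc 0 R₀, φ r * vk u x r := by
      ext x; exact Lop_eq hR₀ hpc hpp hρ hu hc φ x
    rw [this]
    have hm : StronglyMeasurable (fun z : ℝ × ℝ => φ z.2 * vk u z.1 z.2) :=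
      ((Lp.stronglyMeasurable φ).comp_measurable measurable_snd).mul (vk_cont hu).stronglyMeasurable
    exact hm.integral_prod_right'
  have hbd : ∀ x, |LopLp R₀ φ u x| ≤ B x * (c * ‖φ‖) := by
    intro x
    rw [Lop_eq hR₀ hpc hpp hρ hu hc]
    calc |∫ r in Icc 0 R₀, φ r * vk u x r| ≤ ∫ r in Icc 0 R₀, |φ r * vk u x r| :=
          abs_integral_le_integral_abs
      _ ≤ ∫ r in Icc 0 R₀, B x * |φ r| := by
          refine setIntegral_mono_on (Lop_int hR₀ hpc hpp hρ hu hc φ x).abs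
            ((h φ).1.abs.const_mul _) measurableSet_Icc fun r hr => ?_
          rw [abs_mul, mul_comm]
          exact mul_le_mul_of_nonneg_right (hB r hr x) (abs_nonneg _)
      _ ≤ B x * (c * ‖φ‖) := by
          rw [integral_const_mul]
          exact mul_le_mul_of_nonneg_left (h φ).2 (hB0 x)
  have hsq : ∀ x, LopLp R₀ φ u x ^ 2 ≤ (c * ‖φ‖) ^ 2 * B x ^ 2 := by
    intro x
    rw [← sq_abs, ← mul_pow, mul_comm (c * ‖φ‖)]
    exact pow_le_pow_left₀ (abs_nonneg _) (hbd x) 2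
  have hI : Integrable (fun x => LopLp R₀ φ u x ^ 2) := by
    refine Integrable.mono' (hB2.const_mul ((c * ‖φ‖) ^ 2)) (hsm.aestronglyMeasurable.pow 2)
      (ae_of_all _ fun x => ?_)
    rw [Real.norm_eq_abs, abs_of_nonneg (by positivity)]
    exact hsq x
  refine ⟨hsm, ⟨C * (c * ‖φ‖), fun x => (hbd x).trans ?_⟩,
    (memLp_two_iff_integrable_sq hsm.aestronglyMeasurable).2 hI, ?_⟩
  · exact mul_le_mul_of_nonneg_right (hBC x) (by positivity)
  · refine (integral_mono hI (hB2.const_mul _) hsq).trans (le_of_eq ?_)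
    rw [integral_const_mul]; ring

theorem inner_T [IsProbabilityMeasure ρ] (hR₀ : 0 < R₀)
    (hpc : ContinuousOn p (Set.Icc 0 R₀)) (hpp : ∀ r ∈ Set.Icc 0 R₀, 0 < p r)
    (hρ : ρ = (volume.restrict (Set.Icc 0 R₀)).withDensity fun r => ENNReal.ofReal (p r))
    (N : ℕ) (u : Fin N → ℝ → ℝ)
    (hu : ∀ i, Continuous (u i)) (hcs : ∀ i, HasCompactSupport (u i))
    (φ h t : Lp ℝ 2 ρ)
    (ht : (t : ℝ → ℝ) =ᵐ[ρ] fun r => ∫ s, (φ : ℝ → ℝ) s * Gbar N u p r s ∂ρ) :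
    ⟪t, h⟫ = (N : ℝ)⁻¹ * ∑ i, ∫ x, LopLp R₀ φ (u i) x * LopLp R₀ h (u i) x := by
  obtain ⟨c, hc0, hl⟩ := rho_lp hR₀ hpc hpp hρ
  have key : ∀ i, ∀ r ∈ Icc 0 R₀,
      IntegrableOn (fun s => φ s * ∫ x, vk (u i) x r * vk (u i) x s) (Icc 0 R₀) ∧
      ∫ s in Icc 0 R₀, φ s * ∫ x, vk (u i) x r * vk (u i) x s =
        ∫ x, LopLp R₀ φ (u i) x * vk (u i) x r := by
    intro i r hr
    obtain ⟨C, B, hC, hBi, hB0, hBC, hB⟩ := vk_bound R₀ (hu i) (hcs i)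
    have := fub (vk_cont (hu i)) hBi hB φ (Lp.stronglyMeasurable φ) (hl φ).1
      (fun x => vk (u i) x r)
      ((vk_cont (hu i)).comp (Continuous.prodMk_left r)).stronglyMeasurable C
      (fun x => (hB r hr x).trans (hBC x))
    refine ⟨this.1, this.2.trans ?_⟩
    congr 1; ext x; rw [Lop_eq hR₀ hpc hpp hρ (hu i) (hcs i)]; ring
  have key2 : ∀ i,
      IntegrableOn (fun r => h r * ∫ x, LopLp R₀ φ (u i) x * vk (u i) x r) (Icc 0 R₀) ∧
      ∫ r in Icc 0 R₀, h r * ∫ x, LopLp R₀ φ (u i) x * vk (u i) x r =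
        ∫ x, LopLp R₀ φ (u i) x * LopLp R₀ h (u i) x := by
    intro i
    obtain ⟨C, B, hC, hBi, hB0, hBC, hB⟩ := vk_bound R₀ (hu i) (hcs i)
    obtain ⟨K, hK⟩ := Lop_props hR₀ hpc hpp hρ (hu i) (hcs i)
    obtain ⟨h1, ⟨D, hD⟩, -, -⟩ := hK φ
    have := fub (vk_cont (hu i)) hBi hB h (Lp.stronglyMeasurable h) (hl h).1 _ h1 D hD
    refine ⟨this.1, this.2.trans ?_⟩
    congr 1; ext x; rw [Lop_eq hR₀ hpc hpp hρ (hu i) (hcs i) h]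
  have e1 : ⟪t, h⟫ = ∫ r, (∫ s, (φ : ℝ → ℝ) s * Gbar N u p r s ∂ρ) * h r ∂ρ := by
    rw [L2.inner_def]
    refine integral_congr_ae ?_
    filter_upwards [ht] with r hr
    rw [← hr, mul_comm]; rfl
  rw [e1, rho_int hpc hpp hρ]
  have e2 : ∀ r ∈ Icc 0 R₀, p r * ((∫ s, (φ : ℝ → ℝ) s * Gbar N u p r s ∂ρ) * h r) =
      (N : ℝ)⁻¹ * ∑ i, h r * ∫ x, LopLp R₀ φ (u i) x * vk (u i) x r := by
    intro r hr
    have e3 : ∫ s, (φ : ℝ → ℝ) s * Gbar N u p r s ∂ρ =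
        (p r)⁻¹ * ((N : ℝ)⁻¹ * ∑ i, ∫ x, LopLp R₀ φ (u i) x * vk (u i) x r) := by
      rw [rho_int hpc hpp hρ, ← Finset.sum_congr rfl fun i _ => (key i r hr).2,
        ← integral_finsetSum _ fun i _ => (key i r hr).1, ← integral_const_mul,
        ← integral_const_mul]
      refine setIntegral_congr_fun measurableSet_Icc fun s hs => ?_
      have hps := (hpp s hs).ne'
      have hpr := (hpp r hr).ne'
      simp only [Gbar, Gker, ← Finset.mul_sum]
      simp only [vk]
      field_simp
    rw [e3, ← Finset.mul_sum]
    have hpr := (hpp r hr).ne'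
    field_simp
  rw [setIntegral_congr_fun measurableSet_Icc e2, integral_const_mul,
    integral_finsetSum _ fun i _ => (key2 i).1]
  simp only [(key2 _).2]

end

/-- The loss functional is Fréchet differentiable on `L²(ρ)` with gradient `2(L_Ḡ φ - φ^f)`. -/
theorem loss_frechet_derivative (R₀ : ℝ) (hR₀ : 0 < R₀)
    (N : ℕ) (hN : 0 < N) (u : Fin N → ℝ → ℝ)
    (hu : ∀ i, Continuous (u i)) (hcs : ∀ i, HasCompactSupport (u i))
    (f : Fin N → Lp ℝ 2 (volume : Measure ℝ))
    (p : ℝ → ℝ) (hpc : ContinuousOn p (Set.Icc 0 R₀)) (hpp : ∀ r ∈ Set.Icc 0 R₀, 0 < p r)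
    (ρ : Measure ℝ) [IsProbabilityMeasure ρ]
    (hρ : ρ = (volume.restrict (Set.Icc 0 R₀)).withDensity fun r => ENNReal.ofReal (p r))
    (T : Lp ℝ 2 ρ →L[ℝ] Lp ℝ 2 ρ)
    (hT : ∀ φ : Lp ℝ 2 ρ,
      (T φ : ℝ → ℝ) =ᵐ[ρ] fun r => ∫ s, (φ : ℝ → ℝ) s * Gbar N u p r s ∂ρ)
    (φf : Lp ℝ 2 ρ)
    (hφf : ∀ ψ : Lp ℝ 2 ρ,
      ⟪φf, ψ⟫ = (N : ℝ)⁻¹ * ∑ i, ∫ x, LopLp R₀ ψ (u i) x * (f i : ℝ → ℝ) x)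
    (φ : Lp ℝ 2 ρ) :
    HasFDerivAt (fun χ : Lp ℝ 2 ρ => lossE R₀ N u (fun i => (f i : ℝ → ℝ)) χ)
      ((2 : ℝ) • innerSL ℝ (T φ - φf)) φ := by
  have hP := fun i => Lop_props hR₀ hpc hpp hρ (hu i) (hcs i)
  choose K hK using hP
  have hmain : ∀ χ : Lp ℝ 2 ρ, lossE R₀ N u (fun i => (f i : ℝ → ℝ)) χ -
      lossE R₀ N u (fun i => (f i : ℝ → ℝ)) φ - 2 * ⟪T φ - φf, χ - φ⟫ =
      (N : ℝ)⁻¹ * ∑ i, ∫ x, (LopLp R₀ (χ - φ) (u i) x) ^ 2 := by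
    intro χ
    obtain ⟨h, rfl⟩ : ∃ h, χ = φ + h := ⟨χ - φ, by abel⟩
    rw [add_sub_cancel_left, inner_sub_left, hφf h,
      inner_T hR₀ hpc hpp hρ N u hu hcs φ h (T φ) (hT φ)]
    unfold lossE
    have e : ∀ i, ∫ x, (LopLp R₀ (φ + h) (u i) x - (f i : ℝ → ℝ) x) ^ 2 =
        (∫ x, (LopLp R₀ φ (u i) x - (f i : ℝ → ℝ) x) ^ 2) +
        2 * (∫ x, LopLp R₀ φ (u i) x * LopLp R₀ h (u i) x) -
        2 * (∫ x, LopLp R₀ h (u i) x * (f i : ℝ → ℝ) x) +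
        ∫ x, (LopLp R₀ h (u i) x) ^ 2 := by
      intro i
      have m1 := (hK i φ).2.2.1
      have m2 := (hK i h).2.2.1
      have m3 := Lp.memLp (f i)
      have i1 : Integrable (fun x => (LopLp R₀ φ (u i) x - (f i : ℝ → ℝ) x) ^ 2) :=
        (m1.sub m3).integrable_sq
      have i2 : Integrable (fun x => 2 * (LopLp R₀ φ (u i) x * LopLp R₀ h (u i) x)) :=
        (m1.integrable_mul m2).const_mul 2
      have i3 : Integrable (fun x => 2 * (LopLp R₀ h (u i) x * (f i : ℝ → ℝ) x)) :=
        (m2.integrable_mul m3).const_mul 2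
      have i4 : Integrable (fun x => (LopLp R₀ h (u i) x) ^ 2) := m2.integrable_sq
      have e1 := integral_add i1 i2
      have e2 := integral_sub (i1.add i2) i3
      have e3 := integral_add ((i1.add i2).sub i3) i4
      simp only [Pi.add_apply, Pi.sub_apply] at e2 e3
      rw [← integral_const_mul, ← integral_const_mul, ← e1, ← e2, ← e3]
      congr 1; ext x
      rw [Lop_add hR₀ hpc hpp hρ (hu i) (hcs i)]
      ring
    simp only [e, Finset.sum_add_distrib, Finset.sum_sub_distrib, ← Finset.mul_sum]
    ring
  have hO : (fun χ : Lp ℝ 2 ρ => lossE R₀ N u (fun i => (f i : ℝ → ℝ)) χ -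
      lossE R₀ N u (fun i => (f i : ℝ → ℝ)) φ - 2 * ⟪T φ - φf, χ - φ⟫) =O[nhds φ]
      fun χ => ‖χ - φ‖ ^ 2 := by
    refine Asymptotics.IsBigO.of_bound ((N : ℝ)⁻¹ * ∑ i, K i) (Filter.Eventually.of_forall fun χ => ?_)
    rw [hmain χ, Real.norm_eq_abs, Real.norm_eq_abs, abs_of_nonneg (sq_nonneg ‖χ - φ‖),
      abs_of_nonneg, mul_assoc, Finset.sum_mul]
    · gcongr with i
      exact (hK i (χ - φ)).2.2.2
    · exact mul_nonneg (by positivity)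
        (Finset.sum_nonneg fun i _ => integral_nonneg fun x => sq_nonneg _)
  rw [hasFDerivAt_iff_isLittleO]
  have hlo : (fun χ : Lp ℝ 2 ρ => ‖χ - φ‖ ^ 2) =o[nhds φ] fun χ => χ - φ :=
    Asymptotics.isLittleO_pow_sub_sub φ one_lt_two
  refine (hO.trans_isLittleO hlo).congr_left fun χ => ?_
  simp [inner_sub_left]
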